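/- Let S be a numerical semigroup with type t := t(S) and multiplicity μ := μ(S). If τ > μ for every τ ∈ T(S), then |Star(S)| ≥ (2t − 1)·D(t − 1) − 3t + 1, where D(n) is the n-th Dedekind number. -/

import Mathlib

/-- A numerical semigroup: a subset of ℕ containing 0, closed under addition,
with finite complement. -/
structure NumSgp where
  carrier : Set ℕ
  zero_mem : 0 ∈ carrier
  add_mem : ∀ a ∈ carrier, ∀ b ∈ carrier, a + b ∈ carrier
  cofinite : carrierᶜ.Finite

/-- The copy of `S` inside ℤ. -/
def natS (S : NumSgp) : Set ℤ := (fun n : ℕ => (n : ℤ)) '' S.carrier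

/-- A fractional ideal of `S`: a nonempty subset of ℤ, bounded below, with `I + S ⊆ I`. -/
def IsFracIdeal (S : NumSgp) (I : Set ℤ) : Prop :=
  I.Nonempty ∧ BddBelow I ∧ ∀ i ∈ I, ∀ s ∈ natS S, i + s ∈ I

/-- `(I − J) = {x ∈ ℤ : x + J ⊆ I}`. -/
def idealSub (I J : Set ℤ) : Set ℤ := {x : ℤ | ∀ j ∈ J, x + j ∈ I}

/-- `F₀(S)`: fractional ideals `I` with `S ⊆ I ⊆ ℕ` (hence with minimal element 0). -/
def F0 (S : NumSgp) : Set (Set ℤ) :=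
  {I | IsFracIdeal S I ∧ natS S ⊆ I ∧ I ⊆ {x : ℤ | 0 ≤ x}}

/-- The `v`-operation (divisorial closure): `I ↦ (S − (S − I))`. -/
def vOp (S : NumSgp) (I : Set ℤ) : Set ℤ := idealSub (natS S) (idealSub (natS S) I)

/-- An ideal is divisorial if it is `v`-closed. -/
def Divisorial (S : NumSgp) (I : Set ℤ) : Prop := vOp S I = I

/-- `G₀(S)`: the nondivisorial ideals in `F₀(S)`. -/
def G0 (S : NumSgp) : Set (Set ℤ) := {I | I ∈ F0 S ∧ ¬ Divisorial S I}

/-- The action of the star operation `⋆_I` generated by `I`: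
`J ↦ J^{⋆_I} = J^v ∩ (I − (I − J))`. -/
def starI (S : NumSgp) (I J : Set ℤ) : Set ℤ := vOp S J ∩ idealSub I (idealSub I J)

/-- The action of the star operation `⋆_Δ = inf_{I ∈ Δ} ⋆_I` generated by a set `Δ` of ideals:
`J ↦ J^{⋆_Δ} = J^v ∩ ⋂_{I ∈ Δ} (I − (I − J))`. -/
def starD (S : NumSgp) (Δ : Set (Set ℤ)) (J : Set ℤ) : Set ℤ :=
  vOp S J ∩ ⋂ I ∈ Δ, idealSub I (idealSub I J)

/-- The ⋆-order: `I ≤⋆ J` iff `I` is `⋆_J`-closed. -/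
def starle (S : NumSgp) (I J : Set ℤ) : Prop := starI S J I = I

/-- A star operation on `S`, given by its action on subsets of ℤ; it is normalized to be
the identity outside the fractional ideals, so that two star operations are equal iff they
agree on all fractional ideals. -/
structure StarOp (S : NumSgp) where
  toFun : Set ℤ → Set ℤ
  isFrac : ∀ I, IsFracIdeal S I → IsFracIdeal S (toFun I)
  subset_star : ∀ I, IsFracIdeal S I → I ⊆ toFun I
  mono : ∀ I J, IsFracIdeal S I → IsFracIdeal S J → I ⊆ J → toFun I ⊆ toFun J
  idem : ∀ I, IsFracIdeal S I → toFun (toFun I) = toFun I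
  transl : ∀ I, IsFracIdeal S I → ∀ a : ℤ,
    toFun ((fun x => a + x) '' I) = (fun x => a + x) '' toFun I
  star_S : toFun (natS S) = natS S
  default_eq : ∀ I, ¬ IsFracIdeal S I → toFun I = I

/-- The order on star operations: `s ≤ t` iff `I^s ⊆ I^t` for every fractional ideal `I`. -/
def StarOp.le {S : NumSgp} (s t : StarOp S) : Prop :=
  ∀ I, IsFracIdeal S I → s.toFun I ⊆ t.toFun I

/-- A star operation `s` is prime if whenever `s ≥ t ∧ u` (the infimum of two star operations
being given by `I ↦ I^t ∩ I^u`), then `s ≥ t` or `s ≥ u`. -/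
def StarOp.IsPrime {S : NumSgp} (s : StarOp S) : Prop :=
  ∀ t u : StarOp S,
    (∀ I, IsFracIdeal S I → t.toFun I ∩ u.toFun I ⊆ s.toFun I) →
    t.le s ∨ u.le s

/-- `I ∈ F₀(S)` is an atom if the star operation `⋆_I` is prime. -/
def AtomIdeal (S : NumSgp) (I : Set ℤ) : Prop :=
  I ∈ F0 S ∧ ∀ t u : StarOp S,
    (∀ J, IsFracIdeal S J → t.toFun J ∩ u.toFun J ⊆ starI S I J) →
    (∀ J, IsFracIdeal S J → t.toFun J ⊆ starI S I J) ∨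
    (∀ J, IsFracIdeal S J → u.toFun J ⊆ starI S I J)

/-- `M_a = {x ∈ ℕ : a − x ∉ S}`, the biggest ideal in `F₀(S)` not containing `a`. -/
def Mdual (S : NumSgp) (a : ℕ) : Set ℤ := {x : ℤ | 0 ≤ x ∧ ((a : ℤ) - x) ∉ natS S}

/-- `Q_a(S) = {I ∈ F₀(S) : a = sup(ℕ \ I), a ∈ I^v}`. -/
def Qa (S : NumSgp) (a : ℕ) : Set (Set ℤ) :=
  {I | I ∈ F0 S ∧ (a : ℤ) ∉ I ∧ (∀ x : ℤ, (a : ℤ) < x → x ∈ I) ∧ (a : ℤ) ∈ vOp S I}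

/-- The number of antichains (with respect to inclusion) of a family of ideals. -/
noncomputable def numInclAnti (Q : Set (Set ℤ)) : ℕ :=
  Set.ncard {Δ : Set (Set ℤ) | Δ ⊆ Q ∧ IsAntichain (· ⊆ ·) Δ}

/-- The `n`-th Dedekind number: the number of antichains of the power set of an
`n`-element set, ordered by inclusion. -/
noncomputable def dedekind (n : ℕ) : ℕ :=
  Nat.card {A : Set (Set (Fin n)) // IsAntichain (· ⊆ ·) A}

/-- `T(S) = (S − M_S) \ S`. -/
def Tset (S : NumSgp) : Set ℤ :=
  idealSub (natS S) ((fun n : ℕ => (n : ℤ)) '' (S.carrier \ {0})) \ natS S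

/-- The type `t(S) = |T(S)|`. -/
noncomputable def typeNum (S : NumSgp) : ℕ := (Tset S).ncard

/-- The Frobenius number `g(S)`: the largest integer not in `S`. -/
noncomputable def frob (S : NumSgp) : ℕ := sSup S.carrierᶜ

/-- The multiplicity `μ(S)`: the smallest nonzero element of `S`. -/
noncomputable def multNum (S : NumSgp) : ℕ := sInf (S.carrier \ {0})

/-- The degree of singularity `δ(S) = |ℕ \ S|`. -/
noncomputable def deltaNum (S : NumSgp) : ℕ := S.carrierᶜ.ncard

/-- `S` is symmetric if `g(S) − a ∈ S` for every `a ∈ ℕ \ S`. -/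
def IsSymmetricSgp (S : NumSgp) : Prop :=
  ∀ a : ℕ, a ∉ S.carrier → ((frob S : ℤ) - (a : ℤ)) ∈ natS S

/-! ### The closure `J ↦ (I − (I − J))` and the star operations it generates -/

/-- `(I − (I − J))`. -/
def cl (I J : Set ℤ) : Set ℤ := idealSub I (idealSub I J)

theorem mem_cl {I J : Set ℤ} {a : ℤ} :
    a ∈ cl I J ↔ ∀ x, (∀ j ∈ J, x + j ∈ I) → a + x ∈ I := Iff.rfl

theorem subset_cl (I J : Set ℤ) : J ⊆ cl I J := by
  intro j hj x hx
  have := hx j hj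
  rwa [add_comm] at this

theorem cl_mono (I : Set ℤ) {J K : Set ℤ} (h : J ⊆ K) : cl I J ⊆ cl I K := by
  intro a ha x hx
  exact ha x (fun j hj => hx j (h hj))

theorem cl_idem (I J : Set ℤ) : cl I (cl I J) ⊆ cl I J := by
  intro a ha x hx
  apply ha x
  intro j hj
  have := hj x hx
  rwa [add_comm] at this

theorem cl_self (I : Set ℤ) : cl I I ⊆ I := by
  intro a ha
  have := ha 0 (fun j hj => by simpa using hj)
  simpa using this

theorem cl_transl (I J : Set ℤ) (a : ℤ) :
    cl I ((fun x => a + x) '' J) = (fun x => a + x) '' cl I J := by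
  ext y
  constructor
  · intro hy
    refine ⟨y - a, ?_, by simp⟩
    intro x hx
    have := hy (x - a) (by
      rintro _ ⟨j, hj, rfl⟩
      have := hx j hj
      convert this using 1; ring)
    convert this using 1; ring
  · rintro ⟨z, hz, rfl⟩ x hx
    have := hz (x + a) (by
      intro j hj
      have := hx (a + j) ⟨j, hj, rfl⟩
      convert this using 1; ring)
    convert this using 1; ring

theorem cl_ideal (S : NumSgp) (I J : Set ℤ) (hJ : ∀ i ∈ J, ∀ s ∈ natS S, i + s ∈ J) :
    ∀ i ∈ cl I J, ∀ s ∈ natS S, i + s ∈ cl I J := by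
  intro i hi s hs x hx
  have := hi (s + x) (by
    intro j hj
    have := hx _ (hJ j hj s hs)
    convert this using 1; ring)
  convert this using 1; ring

/-- The intersection of the closures attached to `S` and the members of `Δ`. -/
def clD (S : NumSgp) (Δ : Set (Set ℤ)) (J : Set ℤ) : Set ℤ :=
  {a | a ∈ cl (natS S) J ∧ ∀ I ∈ Δ, a ∈ cl I J}

theorem natS_nonneg {S : NumSgp} {x : ℤ} (h : x ∈ natS S) : 0 ≤ x := by
  obtain ⟨n, _, rfl⟩ := h
  exact Int.natCast_nonneg n

theorem natS_zero (S : NumSgp) : (0 : ℤ) ∈ natS S := ⟨0, S.zero_mem, rfl⟩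

theorem natS_add {S : NumSgp} {x y : ℤ} (hx : x ∈ natS S) (hy : y ∈ natS S) :
    x + y ∈ natS S := by
  obtain ⟨n, hn, rfl⟩ := hx
  obtain ⟨m, hm, rfl⟩ := hy
  exact ⟨n + m, S.add_mem n hn m hm, by push_cast; rfl⟩

theorem natS_nsmul {S : NumSgp} {x : ℤ} (hx : x ∈ natS S) (k : ℕ) :
    (k : ℤ) * x ∈ natS S := by
  induction k with
  | zero => simpa using natS_zero S
  | succ k ih =>
    have := natS_add ih hx
    convert this using 1; push_cast; ring

theorem exists_conductor (S : NumSgp) : ∃ c : ℤ, 0 ≤ c ∧ ∀ x, c ≤ x → x ∈ natS S := by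
  obtain ⟨b, hb⟩ := S.cofinite.bddAbove
  refine ⟨b + 1, by positivity, fun x hx => ?_⟩
  refine ⟨x.toNat, ?_, by simp; omega⟩
  by_contra hc
  have := hb hc
  omega

theorem natS_frac (S : NumSgp) : IsFracIdeal S (natS S) :=
  ⟨⟨0, natS_zero S⟩, ⟨0, fun _ h => natS_nonneg h⟩, fun _ h _ h' => natS_add h h'⟩

theorem clD_frac (S : NumSgp) (Δ : Set (Set ℤ)) (J : Set ℤ) (hJ : IsFracIdeal S J) :
    IsFracIdeal S (clD S Δ J) := by
  obtain ⟨⟨j, hj⟩, ⟨b, hb⟩, hs⟩ := hJ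
  refine ⟨⟨j, subset_cl _ _ hj, fun I _ => subset_cl _ _ hj⟩, ?_, ?_⟩
  · obtain ⟨c, hc0, hc⟩ := exists_conductor S
    refine ⟨-(c - b), ?_⟩
    rintro a ⟨ha, _⟩
    have := natS_nonneg (ha (c - b) (fun j hj => hc _ (by have := hb hj; omega)))
    omega
  · rintro i ⟨hi, hi'⟩ s hsS
    exact ⟨cl_ideal S _ _ hs i hi s hsS, fun I hI => cl_ideal S _ _ hs i (hi' I hI) s hsS⟩

open Classical in
/-- The star operation generated by `Δ`. -/
noncomputable def starOf (S : NumSgp) (Δ : Set (Set ℤ)) : StarOp S where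
  toFun J := if IsFracIdeal S J then clD S Δ J else J
  isFrac I hI := by simpa [hI] using clD_frac S Δ I hI
  subset_star I hI := by
    simp only [hI, if_true]
    exact fun x hx => ⟨subset_cl _ _ hx, fun _ _ => subset_cl _ _ hx⟩
  mono I J hI hJ h := by
    simp only [hI, hJ, if_true]
    exact fun x hx => ⟨cl_mono _ h hx.1, fun K hK => cl_mono _ h (hx.2 K hK)⟩
  idem I hI := by
    simp only [hI, clD_frac S Δ I hI, if_true]
    apply Set.Subset.antisymm
    · intro x hx
      refine ⟨cl_idem _ _ (cl_mono _ (fun y hy => hy.1) hx.1), fun K hK => ?_⟩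
      exact cl_idem _ _ (cl_mono _ (fun y hy => hy.2 K hK) (hx.2 K hK))
    · exact fun x hx => ⟨subset_cl _ _ hx, fun _ _ => subset_cl _ _ hx⟩
  transl I hI a := by
    have hI' : IsFracIdeal S ((fun x => a + x) '' I) := by
      obtain ⟨⟨j, hj⟩, ⟨b, hb⟩, hs⟩ := hI
      refine ⟨⟨a + j, j, hj, rfl⟩, ⟨a + b, ?_⟩, ?_⟩
      · rintro _ ⟨x, hx, rfl⟩
        have := hb hx
        simpa using this
      · rintro _ ⟨x, hx, rfl⟩ s hsS
        exact ⟨x + s, hs x hx s hsS, by simp [add_assoc]⟩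
    simp only [hI, hI', if_true]
    ext y
    constructor
    · rintro ⟨h1, h2⟩
      rw [cl_transl] at h1
      obtain ⟨z, hz, rfl⟩ := h1
      refine ⟨z, ⟨hz, fun K hK => ?_⟩, rfl⟩
      have := h2 K hK
      rw [cl_transl] at this
      obtain ⟨w, hw, hwz⟩ := this
      have : w = z := by simpa using hwz
      rwa [← this]
    · rintro ⟨z, ⟨h1, h2⟩, rfl⟩
      refine ⟨?_, fun K hK => ?_⟩
      · rw [cl_transl]; exact ⟨z, h1, rfl⟩
      · rw [cl_transl]; exact ⟨z, h2 K hK, rfl⟩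
  star_S := by
    simp only [natS_frac S, if_true]
    apply Set.Subset.antisymm
    · exact fun x hx => cl_self _ hx.1
    · exact fun x hx => ⟨subset_cl _ _ hx, fun _ _ => subset_cl _ _ hx⟩
  default_eq I hI := by simp [hI]

/-! ### Finiteness of `Star(S)` -/

theorem finite_between (S : NumSgp) (c : ℤ) :
    {X : Set ℤ | natS S ⊆ X ∧ X ⊆ Set.Ici (-c)}.Finite := by
  obtain ⟨d, hd0, hd⟩ := exists_conductor S
  have hfin : (𝒫 (Set.Icc (-c) d)).Finite := (Set.finite_Icc (-c) d).finite_subsets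
  refine Set.Finite.of_finite_image (f := fun X => X ∩ Set.Icc (-c) d)
    (hfin.subset ?_) ?_
  · rintro _ ⟨X, _, rfl⟩
    exact Set.inter_subset_right
  · have key : ∀ X Y : Set ℤ, natS S ⊆ Y → X ⊆ Set.Ici (-c) →
        X ∩ Set.Icc (-c) d = Y ∩ Set.Icc (-c) d → X ⊆ Y := by
      intro X Y hY hX h x hx
      by_cases hxd : x ≤ d
      · have : x ∈ X ∩ Set.Icc (-c) d := ⟨hx, hX hx, hxd⟩
        rw [h] at this
        exact this.1
      · exact hY (hd x (by omega))
    rintro X ⟨hX1, hX2⟩ Y ⟨hY1, hY2⟩ h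
    exact Set.Subset.antisymm (key X Y hY1 hX2 h) (key Y X hX1 hY2 h.symm)

theorem starOp_ext {S : NumSgp} {s t : StarOp S} (h : s.toFun = t.toFun) : s = t := by
  cases s; cases t; cases h; rfl

theorem finite_starOp (S : NumSgp) : Finite (StarOp S) := by
  obtain ⟨c, hc0, hc⟩ := exists_conductor S
  have hF0 : ∀ I ∈ F0 S, natS S ⊆ I ∧ I ⊆ Set.Ici (-c) := by
    rintro I ⟨_, h1, h2⟩
    refine ⟨h1, fun x hx => ?_⟩
    have : 0 ≤ x := h2 hx
    simp only [Set.mem_Ici]; omega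
  have hfin : Finite (F0 S) := ((finite_between S c).subset hF0).to_subtype
  have hfin2 : Finite {X : Set ℤ | natS S ⊆ X ∧ X ⊆ Set.Ici (-c)} :=
    (finite_between S c).to_subtype
  have hmem : ∀ (s : StarOp S) (I : F0 S),
      s.toFun I ∈ {X : Set ℤ | natS S ⊆ X ∧ X ⊆ Set.Ici (-c)} := by
    rintro s ⟨I, hI, h1, h2⟩
    refine ⟨h1.trans (s.subset_star I hI), ?_⟩
    have htr := s.transl (natS S) (natS_frac S) (-c)
    rw [s.star_S] at htr
    have hfr : IsFracIdeal S ((fun x => -c + x) '' natS S) := by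
      refine ⟨⟨-c + 0, 0, natS_zero S, rfl⟩, ⟨-c, ?_⟩, ?_⟩
      · rintro _ ⟨x, hx, rfl⟩
        have := natS_nonneg hx
        simpa using this
      · rintro _ ⟨x, hx, rfl⟩ y hy
        exact ⟨x + y, natS_add hx hy, by simp [add_assoc]⟩
    have := s.mono I _ hI hfr (by
      intro x hx
      have h0 : 0 ≤ x := h2 hx
      exact ⟨x + c, hc _ (by omega), by simp⟩)
    rw [htr] at this
    intro x hx
    obtain ⟨y, hy, rfl⟩ := this hx
    have := natS_nonneg hy
    simpa using this
  refine Finite.of_injective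
    (fun (s : StarOp S) (I : F0 S) =>
      (⟨s.toFun I, hmem s I⟩ : {X : Set ℤ | natS S ⊆ X ∧ X ⊆ Set.Ici (-c)})) ?_
  intro s t hst
  apply starOp_ext
  funext I
  by_cases hI : IsFracIdeal S I
  · obtain ⟨hne, hb, hs⟩ := id hI
    obtain ⟨m, hm, hmin⟩ : ∃ m ∈ I, ∀ x ∈ I, m ≤ x := by
      obtain ⟨b, hb⟩ := hb
      obtain ⟨m, hm, hm'⟩ := Int.exists_least_of_bdd (P := fun x => x ∈ I)
        ⟨b, fun z hz => hb hz⟩ hne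
      exact ⟨m, hm, hm'⟩
    set I' : Set ℤ := (fun x => -m + x) '' I with hI'
    have hfr : IsFracIdeal S I' := by
      refine ⟨⟨_, m, hm, rfl⟩, ⟨0, ?_⟩, ?_⟩
      · rintro _ ⟨x, hx, rfl⟩
        have := hmin x hx
        simp only []; omega
      · rintro _ ⟨x, hx, rfl⟩ y hy
        exact ⟨x + y, hs x hx y hy, by simp [add_assoc]⟩
    have hIF : I' ∈ F0 S := by
      refine ⟨hfr, ?_, ?_⟩
      · intro x hx
        exact ⟨m + x, hs m hm x hx, by simp⟩
      · rintro _ ⟨x, hx, rfl⟩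
        have := hmin x hx
        simp only [Set.mem_setOf_eq]; omega
    have h1 := congrArg Subtype.val (congrFun hst ⟨I', hIF⟩)
    simp only at h1
    have hII : I = (fun x => m + x) '' I' := by
      rw [hI', Set.image_image]; simp
    rw [hII, s.transl I' hfr, t.transl I' hfr, h1]
  · rw [s.default_eq I hI, t.default_eq I hI]

/-! ### The families `Q_a` -/

/-- `I ∈ Q_a(S)`, with `a` an integer. -/
def QZ (S : NumSgp) (a : ℤ) (I : Set ℤ) : Prop :=
  I ∈ F0 S ∧ a ∉ I ∧ (∀ x : ℤ, a < x → x ∈ I) ∧ a ∈ vOp S I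

theorem QZ_mem_same {S : NumSgp} {a : ℤ} {I J : Set ℤ} (hI : QZ S a I) (hJ : QZ S a J)
    (h : ¬ I ⊆ J) : a ∈ cl J I := by
  intro x hx
  have h0 : x ∈ J := by simpa using hx 0 (hI.1.2.1 (natS_zero S))
  have h0' : 0 ≤ x := hJ.1.2.2 h0
  rcases h0'.eq_or_lt with h1 | h1
  · exfalso
    apply h
    intro i hi
    have := hx i hi
    rwa [← h1, zero_add] at this
  · exact hJ.2.2.1 _ (by omega)

theorem QZ_mem_lt {S : NumSgp} {a b : ℤ} {I J : Set ℤ} (hI : QZ S b I) (hJ : QZ S a J)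
    (h : a < b) : b ∈ cl J I := by
  intro x hx
  have h0 : x ∈ J := by simpa using hx 0 (hI.1.2.1 (natS_zero S))
  have h0' : 0 ≤ x := hJ.1.2.2 h0
  exact hJ.2.2.1 _ (by omega)

theorem QZ_mem_gt {S : NumSgp} {a g : ℤ} {I J : Set ℤ} (hI : QZ S a I) (hJ : QZ S g J)
    (h : g - a ∉ J) : a ∈ cl J I := by
  intro x hx
  have h0 : x ∈ J := by simpa using hx 0 (hI.1.2.1 (natS_zero S))
  rcases lt_trichotomy x (g - a) with h1 | h1 | h1
  · exfalso
    apply hJ.2.1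
    have := hx (g - x) (hI.2.2.1 _ (by omega))
    simpa using this
  · exact absurd (h1 ▸ h0) h
  · exact hJ.2.2.1 _ (by omega)

theorem detect {S : NumSgp} {Δ Δ' : Set (Set ℤ)} (h : starOf S Δ = starOf S Δ')
    {a : ℤ} {I : Set ℤ} (hI : QZ S a I) (hm : I ∈ Δ) : ∃ J ∈ Δ', a ∉ cl J I := by
  by_contra hc
  push Not at hc
  have h1 : a ∈ (starOf S Δ').toFun I := by
    simp only [starOf, hI.1.1, if_true]
    exact ⟨hI.2.2.2, hc⟩
  rw [← h] at h1
  simp only [starOf, hI.1.1, if_true] at h1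
  exact hI.2.1 (cl_self I (h1.2 I hm))

theorem anti_eq {n : ℕ} {A A' : Set (Set (Fin n))} (hA : IsAntichain (· ⊆ ·) A)
    (hA' : IsAntichain (· ⊆ ·) A')
    (h : ∀ x ∈ A, ∃ y ∈ A', x ⊆ y) (h' : ∀ x ∈ A', ∃ y ∈ A, x ⊆ y) : A = A' := by
  have key : ∀ (A A' : Set (Set (Fin n))), IsAntichain (· ⊆ ·) A →
      (∀ x ∈ A, ∃ y ∈ A', x ⊆ y) → (∀ x ∈ A', ∃ y ∈ A, x ⊆ y) → A ⊆ A' := by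
    intro A A' hA h h' x hx
    obtain ⟨y, hy, hxy⟩ := h x hx
    obtain ⟨z, hz, hyz⟩ := h' y hy
    have : x = z := hA.eq hx hz (hxy.trans hyz)
    have : x = y := Set.Subset.antisymm hxy (this ▸ hyz)
    exact this ▸ hy
  exact Set.Subset.antisymm (key A A' hA h h') (key A' A hA' h' h)

/-- Separation at the top level. -/
theorem inj_top {S : NumSgp} {n : ℕ} {g : ℤ} (e : Set (Fin n) → Set ℤ)
    (he : ∀ A, A.Nonempty → QZ S g (e A)) (hle : ∀ A B, e A ⊆ e B → A ⊆ B)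
    {B B' : Set (Set (Fin n))} (hB : IsAntichain (· ⊆ ·) B) (hB' : IsAntichain (· ⊆ ·) B')
    (hB0 : ∀ x ∈ B, x.Nonempty) (hB0' : ∀ x ∈ B', x.Nonempty)
    {L L' : Set (Set ℤ)} (hL : ∀ I ∈ L, ∃ a < g, QZ S a I) (hL' : ∀ I ∈ L', ∃ a < g, QZ S a I)
    (h : starOf S (e '' B ∪ L) = starOf S (e '' B' ∪ L')) : B = B' := by
  have key : ∀ (B B' : Set (Set (Fin n))) (L L' : Set (Set ℤ)),
      (∀ x ∈ B, x.Nonempty) → (∀ x ∈ B', x.Nonempty) → (∀ I ∈ L', ∃ a < g, QZ S a I) →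
      starOf S (e '' B ∪ L) = starOf S (e '' B' ∪ L') → ∀ x ∈ B, ∃ y ∈ B', x ⊆ y := by
    intro B B' L L' h0 h0' hL' h x hx
    obtain ⟨J, hJ, hJc⟩ := detect h (he x (h0 x hx)) (Or.inl ⟨x, hx, rfl⟩)
    rcases hJ with ⟨y, hy, rfl⟩ | hJ
    · refine ⟨y, hy, ?_⟩
      by_contra hxy
      exact hJc (QZ_mem_same (he x (h0 x hx)) (he y (h0' y hy)) (fun hh => hxy (hle _ _ hh)))
    · obtain ⟨a, hag, ha⟩ := hL' J hJ
      exact absurd (QZ_mem_lt (he x (h0 x hx)) ha hag) hJc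
  exact anti_eq hB hB' (key B B' L L' hB0 hB0' hL' h) (key B' B L' L hB0' hB0 hL h.symm)

/-- Separation at the lower level. -/
theorem inj_low {S : NumSgp} {g a : ℤ} {P L L' : Set (Set ℤ)}
    (hP : ∀ J ∈ P, QZ S g J ∧ g - a ∉ J) (hL : ∀ I ∈ L, QZ S a I)
    (h : starOf S (P ∪ L) = starOf S (P ∪ L')) : ∀ I ∈ L, ∃ J ∈ L', a ∉ cl J I := by
  intro I hI
  obtain ⟨J, hJ, hJc⟩ := detect h (hL I hI) (Or.inr hI)
  rcases hJ with hJ | hJ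
  · exact absurd (QZ_mem_gt (hL I hI) (hP J hJ).1 (hP J hJ).2) hJc
  · exact ⟨J, hJ, hJc⟩

/-- The abstract counting argument. -/
theorem count {S : NumSgp} {n : ℕ} {g : ℤ} {K : Type} [Finite K]
    (e : ℤ → Set (Fin n) → Set ℤ) (τ : K → ℤ) (b : K → Set (Set (Fin n)))
    (hinj : ∀ k k', τ k = τ k' → b k = b k' → k = k')
    (hτ : ∀ k, τ k < g)
    (hg : ∀ A, A.Nonempty → QZ S g (e g A)) (hgle : ∀ A B, e g A ⊆ e g B → A ⊆ B)
    (he : ∀ k A, QZ S (τ k) (e (τ k) A)) (hle : ∀ k A B, e (τ k) A ⊆ e (τ k) B → A ⊆ B)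
    (hb : ∀ k, IsAntichain (· ⊆ ·) (b k)) (hb0 : ∀ k, ∀ x ∈ b k, x.Nonempty)
    (hbn : ∀ k, ∀ x ∈ b k, g - τ k ∉ e g x) :
    (1 + Nat.card K) * (dedekind n - 1) ≤ Nat.card (StarOp S) := by
  have := finite_starOp S
  let An := {A : Set (Set (Fin n)) // IsAntichain (· ⊆ ·) A}
  have hfinAn : Finite An := inferInstance
  let An1 := {A : An // A ≠ ⟨{∅}, IsAntichain.singleton⟩}
  let An2 := {A : An // A ≠ ⟨∅, IsAntichain.empty⟩}
  have hc : ∀ p : An, Nat.card {A : An // A ≠ p} = dedekind n - 1 := by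
    intro p
    classical
    have := Fintype.ofFinite An
    rw [Nat.card_eq_fintype_card, Fintype.card_subtype_compl, Fintype.card_subtype_eq,
      dedekind, Nat.card_eq_fintype_card]
  have hcard : (1 + Nat.card K) * (dedekind n - 1) = Nat.card (An1 ⊕ K × An2) := by
    rw [Nat.card_sum, Nat.card_prod, hc, hc]; ring
  rw [hcard]
  have hAn1 : ∀ A : An1, ∀ x ∈ A.1.1, x.Nonempty := by
    rintro ⟨⟨A, hA⟩, hne⟩ x hx
    by_contra hx0
    rw [Set.not_nonempty_iff_eq_empty] at hx0
    subst hx0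
    apply hne
    apply Subtype.ext
    apply Set.Subset.antisymm
    · intro y hy
      exact (hA.eq hx hy (Set.empty_subset y)).symm
    · rintro _ rfl
      exact hx
  have hAn2 : ∀ A : An2, A.1.1.Nonempty := by
    rintro ⟨⟨A, hA⟩, hne⟩
    rw [Set.nonempty_iff_ne_empty]
    intro h0
    exact hne (Subtype.ext h0)
  have hlow : ∀ (k : K) (A : Set (Set (Fin n))), ∀ I ∈ e (τ k) '' A, QZ S (τ k) I := by
    rintro k A _ ⟨x, _, rfl⟩
    exact he k x
  have hlow' : ∀ (k : K) (A : Set (Set (Fin n))), ∀ I ∈ e (τ k) '' A, ∃ a < g, QZ S a I :=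
    fun k A I hI => ⟨τ k, hτ k, hlow k A I hI⟩
  have hempty : ∀ I ∈ (∅ : Set (Set ℤ)), ∃ a < g, QZ S a I := by simp
  have hP : ∀ k, ∀ J ∈ e g '' b k, QZ S g J ∧ g - τ k ∉ J := by
    rintro k _ ⟨x, hx, rfl⟩
    exact ⟨hg x (hb0 k x hx), hbn k x hx⟩
  let F : An1 ⊕ K × An2 → StarOp S := fun i => match i with
    | .inl B => starOf S (e g '' B.1.1 ∪ ∅)
    | .inr (k, A) => starOf S (e g '' b k ∪ e (τ k) '' A.1.1)
  have hmix : ∀ (B : An1) (k : K) (A : An2),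
      starOf S (e g '' b k ∪ e (τ k) '' A.1.1) = starOf S (e g '' B.1.1 ∪ ∅) → False := by
    intro B k A h
    have hBe := inj_top (e g) hg hgle (hb k) B.1.2 (hb0 k) (hAn1 B) (hlow' k _) hempty h
    rw [← hBe] at h
    obtain ⟨x, hx⟩ := hAn2 A
    obtain ⟨J, hJ, _⟩ := inj_low (hP k) (hlow k _) h _ ⟨x, hx, rfl⟩
    exact hJ
  refine Nat.card_le_card_of_injective F ?_
  rintro (B | ⟨k, A⟩) (B' | ⟨k', A'⟩) h
  · have := inj_top (e g) hg hgle B.1.2 B'.1.2 (hAn1 B) (hAn1 B') hempty hempty h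
    congr 1
    exact Subtype.ext (Subtype.ext this)
  · exact (hmix B k' A' h.symm).elim
  · exact (hmix B' k A h).elim
  · have h : starOf S (e g '' b k ∪ e (τ k) '' A.1.1) =
        starOf S (e g '' b k' ∪ e (τ k') '' A'.1.1) := h
    have hbb := inj_top (e g) hg hgle (hb k) (hb k') (hb0 k) (hb0 k')
      (hlow' k _) (hlow' k' _) h
    have hle1 : ∀ (k k' : K) (A A' : An2), b k = b k' →
        starOf S (e g '' b k ∪ e (τ k) '' A.1.1) =
        starOf S (e g '' b k' ∪ e (τ k') '' A'.1.1) → τ k ≤ τ k' := by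
      intro k k' A A' hbb h
      rw [← hbb] at h
      obtain ⟨x, hx⟩ := hAn2 A
      obtain ⟨J, hJ, hJc⟩ := inj_low (hP k) (hlow k _) h _ ⟨x, hx, rfl⟩
      by_contra hlt
      push Not at hlt
      exact hJc (QZ_mem_lt (he k x) (hlow k' _ J hJ) hlt)
    have hkk : k = k' :=
      hinj k k' (le_antisymm (hle1 k k' A A' hbb h) (hle1 k' k A' A hbb.symm h.symm)) hbb
    subst hkk
    have hsub : ∀ A A' : An2, starOf S (e g '' b k ∪ e (τ k) '' A.1.1) =
        starOf S (e g '' b k ∪ e (τ k) '' A'.1.1) → ∀ x ∈ A.1.1, ∃ y ∈ A'.1.1, x ⊆ y := by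
      intro A A' h x hx
      obtain ⟨J, hJ, hJc⟩ := inj_low (hP k) (hlow k _) h _ ⟨x, hx, rfl⟩
      obtain ⟨y, hy, rfl⟩ := hJ
      refine ⟨y, hy, ?_⟩
      by_contra hxy
      exact hJc (QZ_mem_same (he k x) (he k y) (fun hh => hxy (hle k _ _ hh)))
    have hAA := anti_eq A.1.2 A'.1.2 (hsub A A' h) (hsub A' A h.symm)
    have : A = A' := Subtype.ext (Subtype.ext hAA)
    rw [this]

/-! ### The ideals built from `T(S)` -/

/-- The representative attached to `σ ∈ T(S)` below `τ`. -/
noncomputable def rep (μ τ σ : ℤ) : ℤ := if σ < τ then σ else τ - (τ - σ) % μ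

/-- The ideal `S ∪ {x > τ} ∪ rep(A)`. -/
def eId (S : NumSgp) (μ τ : ℤ) (A : Set ℤ) : Set ℤ :=
  {x | x ∈ natS S ∨ τ < x ∨ ∃ σ ∈ A, x = rep μ τ σ}

theorem T_add {S : NumSgp} {τ m : ℤ} (hτ : τ ∈ Tset S) (hm : m ∈ natS S) (h0 : m ≠ 0) :
    τ + m ∈ natS S := by
  obtain ⟨n, hn, rfl⟩ := hm
  exact hτ.1 _ ⟨n, ⟨hn, by simpa using h0⟩, rfl⟩

theorem T_congr {S : NumSgp} {μ σ σ' : ℤ} (hμ : μ ∈ natS S) (hμ0 : 0 < μ)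
    (h : σ ∈ Tset S) (h' : σ' ∈ Tset S) (hd : μ ∣ σ - σ') : σ = σ' := by
  have key : ∀ σ σ' : ℤ, σ ∈ Tset S → σ' ∈ Tset S → μ ∣ σ - σ' → ¬ σ' < σ := by
    intro σ σ' h h' hd hlt
    obtain ⟨k, hk⟩ := hd
    have hk0 : 0 < k := by
      by_contra hk0
      push Not at hk0
      nlinarith
    have hmem : μ * k ∈ natS S := by
      have := natS_nsmul hμ k.toNat
      rwa [Int.toNat_of_nonneg hk0.le, mul_comm] at this
    have := T_add h' hmem (by positivity)
    apply h.2
    convert this using 1; omega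
  have h1 := key σ σ' h h' hd
  have h2 := key σ' σ h' h (by rw [← neg_sub]; exact (dvd_neg).2 hd)
  omega

theorem rep_dvd (μ τ σ : ℤ) : μ ∣ σ - rep μ τ σ := by
  unfold rep
  split_ifs
  · simp
  · have : σ - (τ - (τ - σ) % μ) = (τ - σ) % μ - (τ - σ) := by ring
    rw [this]
    have h := Int.dvd_sub_self_of_emod_eq (a := τ - σ) (b := μ) rfl
    rw [← neg_sub]
    exact (dvd_neg).2 (by simpa using Int.dvd_self_sub_emod)

theorem rep_le (μ τ σ : ℤ) (hμ : 0 < μ) : rep μ τ σ ≤ σ ∧ rep μ τ σ ≤ τ := by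
  unfold rep
  split_ifs with h
  · omega
  · have h1 := Int.emod_nonneg (τ - σ) hμ.ne'
    refine ⟨?_, by omega⟩
    omega

theorem rep_notMem {S : NumSgp} {μ τ σ : ℤ} (hμ : μ ∈ natS S) (hμ0 : 0 < μ)
    (h : σ ∈ Tset S) : rep μ τ σ ∉ natS S := by
  intro hm
  obtain ⟨k, hk⟩ := rep_dvd μ τ σ
  have h1 := (rep_le μ τ σ hμ0).1
  have hk0 : 0 ≤ k := by
    by_contra hk0
    push Not at hk0
    nlinarith
  have hmem : μ * k ∈ natS S := by
    have := natS_nsmul hμ k.toNat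
    rwa [Int.toNat_of_nonneg hk0, mul_comm] at this
  apply h.2
  have := natS_add hm hmem
  convert this using 1; omega

theorem eId_le {S : NumSgp} {μ τ : ℤ} {A B : Set ℤ} (hμ : μ ∈ natS S) (hμ0 : 0 < μ)
    (hA : A ⊆ Tset S) (hB : B ⊆ Tset S) (h : eId S μ τ A ⊆ eId S μ τ B) : A ⊆ B := by
  intro σ hσ
  have h1 : rep μ τ σ ∈ eId S μ τ B := h (Or.inr (Or.inr ⟨σ, hσ, rfl⟩))
  rcases h1 with h1 | h1 | ⟨σ', hσ', h1⟩
  · exact absurd h1 (rep_notMem hμ hμ0 (hA hσ))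
  · have := (rep_le μ τ σ hμ0).2
    omega
  · have hd1 := rep_dvd μ τ σ
    have hd2 := rep_dvd μ τ σ'
    have : μ ∣ σ - σ' := by
      have := dvd_sub hd1 hd2
      rw [h1] at this
      simpa using this
    rw [T_congr hμ hμ0 (hA hσ) (hB hσ') this]
    exact hσ'

theorem eId_QZ {S : NumSgp} {μ τ : ℤ} {A : Set ℤ} (hμ : μ ∈ natS S) (hμ0 : 0 < μ)
    (hμm : ∀ m ∈ natS S, m ≠ 0 → μ ≤ m) (hT : ∀ τ ∈ Tset S, μ < τ)
    (hτ : τ ∈ Tset S) (hA : A ⊆ Tset S) (hAτ : τ ∉ A)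
    (hne : ¬ eId S μ τ A ⊆ natS S) : QZ S τ (eId S μ τ A) := by
  have hsub : natS S ⊆ eId S μ τ A := fun x hx => Or.inl hx
  have hnn : ∀ x ∈ eId S μ τ A, 0 ≤ x := by
    rintro x (hx | hx | ⟨σ, hσ, rfl⟩)
    · exact natS_nonneg hx
    · have := hT τ hτ; omega
    · have h1 := hT σ (hA hσ)
      have h2 := hT τ hτ
      unfold rep
      split_ifs
      · omega
      · have := Int.emod_lt_of_pos (τ - σ) hμ0
        omega
  refine ⟨⟨⟨⟨0, hsub (natS_zero S)⟩, ⟨0, hnn⟩, ?_⟩, hsub, hnn⟩, ?_, ?_, ?_⟩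
  · rintro x (hx | hx | ⟨σ, hσ, rfl⟩) s hs
    · exact Or.inl (natS_add hx hs)
    · have := natS_nonneg hs
      exact Or.inr (Or.inl (by omega))
    · by_cases hs0 : s = 0
      · subst hs0
        exact Or.inr (Or.inr ⟨σ, hσ, by simp⟩)
      · have hms := hμm s hs hs0
        unfold rep
        split_ifs
        · exact Or.inl (T_add (hA hσ) hs hs0)
        · have := Int.emod_lt_of_pos (τ - σ) hμ0
          exact Or.inr (Or.inl (by omega))
  · rintro (hx | hx | ⟨σ, hσ, hx⟩)
    · exact hτ.2 hx
    · omega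
    · have hd := rep_dvd μ τ σ
      rw [← hx] at hd
      have := T_congr hμ hμ0 (hA hσ) hτ hd
      exact hAτ (this ▸ hσ)
  · exact fun x hx => Or.inr (Or.inl hx)
  · intro y hy
    have hyS : y ∈ natS S := by simpa using hy 0 (hsub (natS_zero S))
    by_cases hy0 : y = 0
    · subst hy0
      exact absurd (fun x hx => by simpa using hy x hx) hne
    · exact T_add hτ hyS hy0

theorem dedekind_one : dedekind 1 ≤ 3 := by
  classical
  have : Fintype.card {A : Set (Set (Fin 1)) // IsAntichain (· ⊆ ·) A} <
      Fintype.card (Set (Set (Fin 1))) := by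
    apply Fintype.card_subtype_lt (x := Set.univ)
    intro h
    have := h.eq (Set.mem_univ (∅ : Set (Fin 1))) (Set.mem_univ Set.univ) (Set.empty_subset _)
    exact Set.empty_ne_univ this
  rw [dedekind, Nat.card_eq_fintype_card]
  have h4 : Fintype.card (Set (Set (Fin 1))) = 4 := by simp
  omega

theorem exists_mult (S : NumSgp) : ((multNum S : ℕ) : ℤ) ∈ natS S ∧ 0 < (multNum S : ℤ) ∧
    ∀ m ∈ natS S, m ≠ 0 → (multNum S : ℤ) ≤ m := by
  have hne : (S.carrier \ {0}).Nonempty := by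
    obtain ⟨c, hc0, hc⟩ := exists_conductor S
    obtain ⟨n, hn, hn'⟩ := hc (c + 1) (by omega)
    refine ⟨n, hn, ?_⟩
    simp only [Set.mem_singleton_iff]
    rintro rfl
    simp at hn'; omega
  have hmem := Nat.sInf_mem hne
  refine ⟨⟨_, hmem.1, rfl⟩, ?_, ?_⟩
  · have : multNum S ≠ 0 := hmem.2
    omega
  · rintro _ ⟨n, hn, rfl⟩ h0
    have : multNum S ≤ n := Nat.sInf_le ⟨hn, by simpa using h0⟩
    exact Int.ofNat_le.2 this

theorem exists_frob (S : NumSgp) (h : ∀ τ ∈ Tset S, (multNum S : ℤ) < τ) :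
    ∃ g ∈ Tset S, ∀ x, g < x → x ∈ natS S := by
  obtain ⟨c, hc0, hc⟩ := exists_conductor S
  obtain ⟨g, hg, hgm⟩ := Int.exists_greatest_of_bdd (P := fun x => x ∉ natS S)
    ⟨c, fun z hz => by
      by_contra hlt
      push Not at hlt
      exact hz (hc z hlt.le)⟩
    ⟨-1, fun hh => by have := natS_nonneg hh; omega⟩
  refine ⟨g, ⟨?_, hg⟩, fun x hx => ?_⟩
  · rintro _ ⟨n, ⟨hn, hn0⟩, rfl⟩
    by_contra hc
    have := hgm _ hc
    have : n ≠ 0 := by simpa using hn0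
    simp only at *
    omega
  · by_contra hc
    have := hgm _ hc
    omega

/-- If every `τ ∈ T(S)` satisfies `τ > μ(S)`, then
`|Star(S)| ≥ (2t − 1)·D(t − 1) − 3t + 1`. -/
theorem card_star_ge_of_type_gt_mult (S : NumSgp)
    (h : ∀ τ ∈ Tset S, (multNum S : ℤ) < τ) :
    (2 * (typeNum S : ℤ) - 1) * (dedekind (typeNum S - 1) : ℤ) -
        3 * (typeNum S : ℤ) + 1 ≤ (Nat.card (StarOp S) : ℤ) := by
  obtain ⟨hμ, hμ0, hμm⟩ := exists_mult S
  obtain ⟨g, hgT, hg⟩ := exists_frob S h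
  set μ : ℤ := (multNum S : ℤ) with hμdef
  have hTle : ∀ τ ∈ Tset S, τ ≤ g := by
    intro τ hτ
    by_contra hlt
    push Not at hlt
    exact hτ.2 (hg τ hlt)
  have hTfin : (Tset S).Finite := (Set.finite_Icc 0 g).subset (fun τ hτ =>
    ⟨by have := h τ hτ; omega, hTle τ hτ⟩)
  have ht : 1 ≤ typeNum S := (Set.ncard_pos hTfin).2 ⟨g, hgT⟩
  obtain ⟨n, hn⟩ : ∃ n, typeNum S = n + 1 := ⟨typeNum S - 1, by omega⟩
  have hncard : (Tset S).ncard = n + 1 := hn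
  have hequiv : ∀ τ : ℤ, ∃ f : Fin n → ℤ, τ ∈ Tset S →
      Function.Injective f ∧ Set.range f = Tset S \ {τ} := by
    intro τ
    by_cases hτ : τ ∈ Tset S
    · have hfin : (Tset S \ {τ}).Finite := hTfin.subset Set.diff_subset
      have hc : (Tset S \ {τ}).ncard = n := by
        rw [Set.ncard_diff_singleton_of_mem hτ]; omega
      have : Finite ↥(Tset S \ {τ}) := hfin.to_subtype
      have e : Fin n ≃ ↥(Tset S \ {τ}) := (Finite.equivFinOfCardEq (by
        rw [Nat.card_coe_set_eq, hc])).symm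
      refine ⟨fun i => (e i).1, fun _ => ⟨Subtype.val_injective.comp e.injective, ?_⟩⟩
      have : (fun i => (e i).1) = Subtype.val ∘ e := rfl
      rw [this, Set.range_comp, e.surjective.range_eq, Set.image_univ, Subtype.range_coe]
    · exact ⟨fun _ => 0, fun hc => absurd hc hτ⟩
  choose f hf using hequiv
  let e : ℤ → Set (Fin n) → Set ℤ := fun τ A => eId S μ τ (f τ '' A)
  have hfT : ∀ τ ∈ Tset S, ∀ i, f τ i ∈ Tset S \ {τ} := fun τ hτ i => by
    rw [← (hf τ hτ).2]; exact ⟨i, rfl⟩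
  have hsubT : ∀ τ ∈ Tset S, ∀ A, f τ '' A ⊆ Tset S := by
    rintro τ hτ A _ ⟨i, _, rfl⟩
    exact (hfT τ hτ i).1
  have hnotA : ∀ τ ∈ Tset S, ∀ A, τ ∉ f τ '' A := by
    rintro τ hτ A ⟨i, _, hi⟩
    exact (hfT τ hτ i).2 hi
  have hle : ∀ τ ∈ Tset S, ∀ A B, e τ A ⊆ e τ B → A ⊆ B := by
    intro τ hτ A B hAB
    have := eId_le hμ hμ0 (hsubT τ hτ A) (hsubT τ hτ B) hAB
    exact (Set.image_subset_image_iff (hf τ hτ).1).1 this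
  have hQg : ∀ A, A.Nonempty → QZ S g (e g A) := by
    rintro A ⟨i, hi⟩
    refine eId_QZ hμ hμ0 hμm h hgT (hsubT g hgT A) (hnotA g hgT A) (fun hc => ?_)
    exact rep_notMem hμ hμ0 (hfT g hgT i).1 (hc (Or.inr (Or.inr ⟨f g i, ⟨i, hi, rfl⟩, rfl⟩)))
  have hQ : ∀ τ ∈ Tset S \ {g}, ∀ A, QZ S τ (e τ A) := by
    rintro τ ⟨hτ, hτg⟩ A
    refine eId_QZ hμ hμ0 hμm h hτ (hsubT τ hτ A) (hnotA τ hτ A) (fun hc => ?_)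
    have hlt : τ < g := lt_of_le_of_ne (hTle τ hτ) hτg
    exact hgT.2 (hc (Or.inr (Or.inl hlt)))
  have hτlt : ∀ i, f g i < g := fun i =>
    lt_of_le_of_ne (hTle _ (hfT g hgT i).1) (hfT g hgT i).2
  have hnk : typeNum S - 1 = n := by omega
  rw [hnk, hn]
  have hD : 0 < dedekind n := by
    rw [dedekind]
    have : Nonempty {A : Set (Set (Fin n)) // IsAntichain (· ⊆ ·) A} := ⟨⟨∅, IsAntichain.empty⟩⟩
    exact Nat.card_pos
  by_cases hn2 : n ≤ 1
  · have hc := count (S := S) (g := g) (K := Fin n) e (fun i => f g i) (fun _ => ∅)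
      (fun k k' hk _ => (hf g hgT).1 hk) hτlt hQg (hle g hgT)
      (fun k A => hQ _ (hfT g hgT k) A) (fun k => hle _ (hfT g hgT k).1)
      (fun k => IsAntichain.empty) (by simp) (by simp)
    rw [Nat.card_eq_fintype_card, Fintype.card_fin] at hc
    have hn01 : n = 0 ∨ n = 1 := by omega
    have hd1 := dedekind_one
    rcases hn01 with rfl | rfl
    · have hd0 : dedekind 0 ≤ 2 := by
        rw [dedekind]
        have := Nat.card_le_card_of_injective
          (Subtype.val : {A : Set (Set (Fin 0)) // IsAntichain (· ⊆ ·) A} → Set (Set (Fin 0)))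
          Subtype.val_injective
        simpa using this
      push_cast
      omega
    · push_cast
      omega
  · have hex : ∀ i : Fin n, ∃ j : Fin n, f g j ≠ g - f g i := by
      intro i
      by_contra hc
      push Not at hc
      have := (hf g hgT).1 ((hc ⟨0, by omega⟩).trans (hc ⟨1, by omega⟩).symm)
      simp at this
    choose j hj using hex
    have hc := count (S := S) (g := g) (K := Fin n × Bool) e (fun k => f g k.1)
      (fun k => if k.2 then {{j k.1}} else ∅)
      (by
        rintro ⟨i, x⟩ ⟨i', x'⟩ hk hb
        have hii : i = i' := (hf g hgT).1 hk
        subst hii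
        cases x <;> cases x' <;> simp_all)
      (fun k => hτlt k.1) hQg (hle g hgT)
      (fun k A => hQ _ (hfT g hgT k.1) A) (fun k => hle _ (hfT g hgT k.1).1)
      (by
        rintro ⟨i, x⟩
        cases x
        · exact IsAntichain.empty
        · exact IsAntichain.singleton)
      (by
        rintro ⟨i, x⟩ y hy
        cases x
        · simp at hy
        · simp at hy
          subst hy
          simp)
      (by
        rintro ⟨i, x⟩ y hy
        cases x
        · simp at hy
        · simp at hy
          subst hy
          have hi := hfT g hgT i
          have hlt := hτlt i
          rintro (hm | hm | ⟨σ, hσ, hm⟩)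
          · have := T_add hi.1 hm (by simp only; omega)
            apply hgT.2
            convert this using 1; simp
          · have := h _ hi.1
            simp only at hm
            omega
          · simp at hσ
            subst hσ
            have : rep μ g (f g (j i)) = f g (j i) := if_pos (hτlt _)
            rw [this] at hm
            exact hj i hm.symm)
    rw [Nat.card_prod, Nat.card_eq_fintype_card, Fintype.card_fin, Nat.card_eq_fintype_card,
      Fintype.card_bool] at hc
    obtain ⟨d, hd⟩ : ∃ d, dedekind n = d + 1 := ⟨dedekind n - 1, by omega⟩
    rw [hd] at hc ⊢
    have hc' : ((1 + (n : ℤ) * 2) * d) ≤ (Nat.card (StarOp S) : ℤ) := by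
      exact_mod_cast hc
    push_cast
    nlinarith
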